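/- Fix y = (y₁,y₂) ∈ ℝ² with y₂ > 0 and vectors g, ν ∈ ℝ². Define u^{R,W}ᵢ(x) = Σⱼ Σₖ Tᴿᵢⱼₖ(x,y) νₖ gⱼ − Σⱼ Σₖ Tᴿᵢⱼₖ(x,yᴵ) νᴵₖ gᴵⱼ − [x₂ ∂φᴿ/∂xᵢ(x) − δᵢ₂ φᴿ(x)], where φᴿ(x) = −2 νᴵ₂ Gᴰ[gᴵ](x,yᴵ) + 2 gᴵ₂ Gᴰ[νᴵ](x,yᴵ). Then u^{R,W} satisfies the no-slip condition: u^{R,W}ᵢ(x) = 0 for i = 1,2 and every x = (x₁,0) with x ≠ yᴵ. -/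

import Mathlib

open Real Finset

noncomputable section

/-- Points in two-dimensional Euclidean space. -/
abbrev E2 := EuclideanSpace ℝ (Fin 2)

/-- Partial derivative `∂f/∂xᵢ` of a scalar field on `ℝ²`. -/
def pd (i : Fin 2) (f : E2 → ℝ) (x : E2) : ℝ :=
  fderiv ℝ f x (EuclideanSpace.single i 1)

/-- Kronecker delta. -/
def kron (i j : Fin 2) : ℝ := if i = j then 1 else 0

/-- Reflected image point `yᴵ = (y₁, -y₂)`. -/
def reflPt (y : E2) : E2 := (EuclideanSpace.equiv (Fin 2) ℝ).symm ![y 0, -y 1]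

/-- Reflected vector `fᴵ = (f₁, -f₂)`. -/
def reflVec (f : Fin 2 → ℝ) : Fin 2 → ℝ := ![f 0, -f 1]

/-- Two-dimensional free-space Laplace Green's function `Gˢ(x,y) = -(1/2π) log|x-y|`. -/
def GS (x y : E2) : ℝ := -(1 / (2 * π)) * Real.log ‖x - y‖

/-- Two-dimensional dipole potential `Gᴰ[ν](x,y) = Σᵢ νᵢ ∂/∂yᵢ Gˢ(x,y)`. -/
def GD (ν : Fin 2 → ℝ) (x y : E2) : ℝ := ∑ i, ν i * pd i (fun z => GS x z) y

/-- Two-dimensional quadrupole potential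
`G^Q[ν,κ](x,y) = Σᵢ Σⱼ νᵢ κⱼ ∂²/∂yᵢ∂yⱼ Gˢ(x,y)`. -/
def GQ (ν κ : Fin 2 → ℝ) (x y : E2) : ℝ :=
  ∑ i, ∑ j, ν i * κ j * pd i (fun z => pd j (fun w => GS x w) z) y

/-- The two-dimensional rotlet (antisymmetric part of the Stokes doublet)
`Tᴿᵢⱼₖ(x,y) = (1/2π)[-(xⱼ-yⱼ)δᵢₖ/|x-y|² + (xₖ-yₖ)δᵢⱼ/|x-y|²]`. -/
def TR2 (x y : E2) (i j k : Fin 2) : ℝ :=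
  (1 / (2 * π)) * (-(x j - y j) * kron i k / ‖x - y‖ ^ 2
    + (x k - y k) * kron i j / ‖x - y‖ ^ 2)

/-- The two-dimensional Papkovich–Neuber potential for the rotlet image system:
`φᴿ(x) = -2 νᴵ₂ Gᴰ[gᴵ](x,yᴵ) + 2 gᴵ₂ Gᴰ[νᴵ](x,yᴵ)`. -/
def phiR2 (y : E2) (g ν : Fin 2 → ℝ) (x : E2) : ℝ :=
  -2 * reflVec ν 1 * GD (reflVec g) x (reflPt y)
    + 2 * reflVec g 1 * GD (reflVec ν) x (reflPt y)

/-- The half-plane rotlet velocity `u^{R,W}`. -/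
def uRW2 (y : E2) (g ν : Fin 2 → ℝ) (i : Fin 2) (x : E2) : ℝ :=
  (∑ j, ∑ k, TR2 x y i j k * ν k * g j)
    - (∑ j, ∑ k, TR2 x (reflPt y) i j k * reflVec ν k * reflVec g j)
    - (x 1 * pd i (phiR2 y g ν) x - if i = 1 then phiR2 y g ν x else 0)

theorem norm_sub_sq_eq (x y : E2) :
    ‖x - y‖ ^ 2 = (x 0 - y 0) ^ 2 + (x 1 - y 1) ^ 2 := by
  simp [EuclideanSpace.norm_sq_eq, Fin.sum_univ_two]

theorem pd_GS {x y : E2} (h : x ≠ y) (i : Fin 2) :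
    pd i (fun z => GS x z) y = 1 / (2 * π) * ((x i - y i) / ‖x - y‖ ^ 2) := by
  have hn : ‖x - y‖ ^ 2 ≠ 0 := by simpa [sub_eq_zero] using h
  have hGS : (fun z => GS x z) = fun z => -(1 / (4 * π)) * Real.log (‖x - z‖ ^ 2) := by
    funext z
    rw [GS, Real.log_pow]
    push_cast
    ring
  have hd := ((((hasFDerivAt_id y).const_sub x).norm_sq).log hn).const_mul (-(1 / (4 * π)))
  have hd' : HasFDerivAt (fun z => GS x z) _ y := hGS ▸ hd
  rw [pd, hd'.fderiv]
  simp [EuclideanSpace.inner_single_right]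
  ring

theorem GD_eq {x y : E2} (h : x ≠ y) (ν : Fin 2 → ℝ) :
    GD ν x y = 1 / (2 * π) *
      ((ν 0 * (x 0 - y 0) + ν 1 * (x 1 - y 1)) / ‖x - y‖ ^ 2) := by
  simp only [GD, Fin.sum_univ_two, pd_GS h]
  ring

theorem reflPt_zero (y : E2) : reflPt y 0 = y 0 := rfl

theorem reflPt_one (y : E2) : reflPt y 1 = -y 1 := rfl

theorem norm_sub_reflPt_sq {x : E2} (hx : x 1 = 0) (y : E2) :
    ‖x - reflPt y‖ ^ 2 = ‖x - y‖ ^ 2 := by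
  simp [norm_sub_sq_eq, reflPt_zero, reflPt_one, hx]

/-- the half-plane rotlet `u^{R,W}` satisfies the no-slip
condition on the line `x₂ = 0`. -/
theorem rotlet_halfplane_no_slip (y : E2) (hy : 0 < y 1) (g ν : Fin 2 → ℝ) :
    ∀ x : E2, x 1 = 0 → x ≠ reflPt y → ∀ i, uRW2 y g ν i x = 0 := by
  intro x hx hne i
  fin_cases i <;>
    simp [uRW2, TR2, phiR2, GD_eq hne, norm_sub_reflPt_sq hx, Fin.sum_univ_two, kron, reflVec,
      reflPt_zero, reflPt_one, hx] <;>
    ring
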